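/- For every node v of an Emerson-Lei game G, the existential player wins v in G if and only if the existential player wins the node (v, r) in the parity game P_G, where r is the root of the Zielonka tree Z_φ. -/

import Mathlib

/-- Emerson-Lei formulas over a set `C` of colors: Boolean formulas over atoms `Inf c`. -/
inductive ELFormula (C : Type) : Type
  | tt : ELFormula C
  | ff : ELFormula C
  | inf : C → ELFormula C
  | not : ELFormula C → ELFormula C
  | and : ELFormula C → ELFormula C → ELFormula C
  | or : ELFormula C → ELFormula C → ELFormula C

/-- Satisfaction of an Emerson-Lei formula by a set `D` of colors. -/
def ELSat {C : Type} (D : Set C) : ELFormula C → Prop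
  | .tt => True
  | .ff => False
  | .inf c => c ∈ D
  | .not f => ¬ ELSat D f
  | .and f g => ELSat D f ∧ ELSat D g
  | .or f g => ELSat D f ∨ ELSat D g

/-- `D` is a candidate child-label for a vertex labeled `L`:
`D ⊊ L` and `D ⊨ φ ⟺ L ⊭ φ`. -/
def ELCand {C : Type} [DecidableEq C] (φ : ELFormula C) (L D : Finset C) : Prop :=
  D ⊂ L ∧ (ELSat (↑D) φ ↔ ¬ ELSat (↑L) φ)

/-- `D` is maximal among the candidate child-labels for a vertex labeled `L`. -/
def ELMaxCand {C : Type} [DecidableEq C] (φ : ELFormula C) (L D : Finset C) : Prop :=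
  ELCand φ L D ∧ ∀ D' : Finset C, ELCand φ L D' → D ⊆ D' → D = D'

/-- The Zielonka tree of an Emerson-Lei formula `φ` over a finite set `C` of colors:
a finite tree rooted at `root`, whose root is labeled `C`, and in which every vertex `s`
has exactly one child labeled `D` for each `D` maximal among
`{D' ⊊ l(s) | D' ⊨ φ ⟺ l(s) ⊭ φ}`. -/
structure ZielonkaTree (C : Type) [Fintype C] [DecidableEq C] (φ : ELFormula C) where
  V : Type
  [finV : Fintype V]
  [decV : DecidableEq V]
  root : V
  children : V → Finset V
  label : V → Finset C
  root_label : label root = Finset.univ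
  reach_root : ∀ t, Relation.ReflTransGen (fun a b => b ∈ children a) root t
  parent_unique : ∀ ⦃s s' t⦄, t ∈ children s → t ∈ children s' → s = s'
  root_not_child : ∀ s, root ∉ children s
  child_maximal : ∀ ⦃s t⦄, t ∈ children s → ELMaxCand φ (label s) (label t)
  child_exists : ∀ ⦃s⦄ ⦃D : Finset C⦄, ELMaxCand φ (label s) D → ∃ t ∈ children s, label t = D
  child_label_inj : ∀ ⦃s t t'⦄, t ∈ children s → t' ∈ children s → label t = label t' → t = t'

attribute [instance] ZielonkaTree.finV ZielonkaTree.decV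

/-- A game arena: a set of nodes (the type `N`) partitioned into existential nodes
(`Vex`) and universal nodes (the complement), with a move relation `E` such that every
node has at least one successor. -/
structure Arena (N : Type) where
  Vex : Set N
  E : N → Set N
  E_nonempty : ∀ v, (E v).Nonempty

/-- A play of an arena: an infinite sequence of nodes following moves. -/
def Arena.IsPlay {N : Type} (A : Arena N) (π : ℕ → N) : Prop :=
  ∀ i, π (i + 1) ∈ A.E (π i)

/-- The existential player wins node `v` for objective `α`: there is a strategy
(mapping a history together with a current existential node to a successor) such that
every play starting at `v` and compliant with it satisfies `α`. -/
def WinsFrom {N : Type} (A : Arena N) (α : (ℕ → N) → Prop) (v : N) : Prop :=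
  ∃ σ : List N → N → N,
    (∀ h u, u ∈ A.Vex → σ h u ∈ A.E u) ∧
    ∀ π : ℕ → N, A.IsPlay π → π 0 = v →
      (∀ i, π i ∈ A.Vex → π (i + 1) = σ ((List.range i).map π) (π i)) → α π

/-- The Emerson-Lei objective `α_{γ,φ}`: the set of colors visited infinitely often
by the play satisfies `φ`. -/
def ELObjective {N C : Type} (γ : N → Finset C) (φ : ELFormula C) (π : ℕ → N) : Prop :=
  ELSat {c : C | ∀ M : ℕ, ∃ i ≥ M, c ∈ γ (π i)} φ

namespace ZielonkaTree

variable {C : Type} [Fintype C] [DecidableEq C] {φ : ELFormula C}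

/-- The ancestor ordering of the Zielonka tree: `Z.anc s t` iff `s` is an ancestor of `t`
(or `s = t`). -/
def anc (Z : ZielonkaTree C φ) (s t : Z.V) : Prop :=
  Relation.ReflTransGen (fun a b => b ∈ Z.children a) s t

/-- A leaf of the Zielonka tree. -/
def IsLeaf (Z : ZielonkaTree C φ) (t : Z.V) : Prop := Z.children t = ∅

/-- A winning vertex of the Zielonka tree (an element of `T_□`): its label satisfies `φ`. -/
def Winning (Z : ZielonkaTree C φ) (t : Z.V) : Prop := ELSat (↑(Z.label t)) φ

/-- `s` is the anchor node of `t` at a node colored `g`: the lowermost ancestor of `t`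
whose label contains `g`. -/
def IsAnchor (Z : ZielonkaTree C φ) (g : Finset C) (t s : Z.V) : Prop :=
  Z.anc s t ∧ g ⊆ Z.label s ∧ ∀ s', Z.anc s' t → g ⊆ Z.label s' → Z.anc s' s

end ZielonkaTree

/-- Being a leaf is decidable. -/
instance ZielonkaTree.decIsLeaf {C : Type} [Fintype C] [DecidableEq C] {φ : ELFormula C}
    (Z : ZielonkaTree C φ) (t : Z.V) : Decidable (Z.IsLeaf t) := by
  have : DecidableEq Z.V := Z.decV
  unfold ZielonkaTree.IsLeaf
  infer_instance

open ZielonkaTree in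
/-- The parity game `P_G` obtained from an Emerson-Lei game `G` and the Zielonka tree
`Z_φ`: nodes are pairs `(v, t)`; a node `(v,t)` is existential iff (`t` is not a leaf and
`t` is losing) or (`t` is a leaf and `v` is existential); from a non-leaf `t` the moves go
to `(v, t')` for children `t'` of `t`, and from a leaf `t` the moves go to
`(w, anchor(v,t))` for moves `(v,w)` of `G`. -/
def PArena {C N : Type} [Fintype C] [DecidableEq C] {φ : ELFormula C}
    (A : Arena N) (Z : ZielonkaTree C φ) (anch : N → Z.V → Z.V) : Arena (N × Z.V) where
  Vex := {p | (¬ Z.IsLeaf p.2 ∧ ¬ Z.Winning p.2) ∨ (Z.IsLeaf p.2 ∧ p.1 ∈ A.Vex)}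
  E := fun p =>
    if Z.IsLeaf p.2 then {q | q.1 ∈ A.E p.1 ∧ q.2 = anch p.1 p.2}
    else {q | q.1 = p.1 ∧ q.2 ∈ Z.children p.2}
  E_nonempty := by
    intro p
    by_cases h : Z.IsLeaf p.2
    · obtain ⟨u, hu⟩ := A.E_nonempty p.1
      exact ⟨(u, anch p.1 p.2), by simp [h, hu]⟩
    · obtain ⟨c, hc⟩ := Finset.nonempty_iff_ne_empty.mpr h
      exact ⟨(p.1, c), by simp [h, hc]⟩

open Classical in
/-- The priority function of `P_G`: `Ω(v,t) = 2·lev(t)` if `t` is a winning vertex and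
`Ω(v,t) = 2·lev(t) + 1` if `t` is losing. -/
noncomputable def POmega {C N : Type} [Fintype C] [DecidableEq C] {φ : ELFormula C}
    (Z : ZielonkaTree C φ) (lev : Z.V → ℕ) (p : N × Z.V) : ℕ :=
  if Z.Winning p.2 then 2 * lev p.2 else 2 * lev p.2 + 1

/-- The parity objective: the maximal priority visited infinitely often is even. -/
def ParityWin {X : Type} (Ω : X → ℕ) (π : ℕ → X) : Prop :=
  ∃ p : ℕ, Even p ∧ (∀ M : ℕ, ∃ i ≥ M, Ω (π i) = p) ∧
    ∀ q : ℕ, (∀ M : ℕ, ∃ i ≥ M, Ω (π i) = q) → q ≤ p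

open Filter

theorem Filter.Frequently.exists_of_finite {ι α : Type*} [Finite ι] {f : Filter α}
    {p : ι → α → Prop} (h : ∃ᶠ x in f, ∃ i, p i x) : ∃ i, ∃ᶠ x in f, p i x := by
  by_contra! hc
  exact h ((eventually_all.2 hc).mono fun x hx ⟨i, hi⟩ => hx i hi)

namespace ZielonkaTree

variable {C N : Type} [Fintype C] [DecidableEq C] {φ : ELFormula C} {Z : ZielonkaTree C φ}

theorem anc.label_subset {s t : Z.V} (h : Z.anc s t) : Z.label t ⊆ Z.label s := by
  induction h with
  | refl => exact subset_rfl
  | tail _ hc ih => exact (Z.child_maximal hc).1.1.1.trans ih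

theorem anc.total {s s' t : Z.V} (h : Z.anc s t) (h' : Z.anc s' t) :
    Z.anc s s' ∨ Z.anc s' s := by
  have := Relation.ReflTransGen.total_of_right_unique
    (r := Function.swap fun a b => b ∈ Z.children a)
    (fun a b c hb hc => Z.parent_unique hb hc)
    (Relation.reflTransGen_swap.2 h) (Relation.reflTransGen_swap.2 h')
  exact this.symm.imp Relation.reflTransGen_swap.1 Relation.reflTransGen_swap.1

theorem anc.eq_or_lt {lev : Z.V → ℕ} (hlev : ∀ s t : Z.V, t ∈ Z.children s → lev s = lev t + 1)
    {s t : Z.V} (h : Z.anc s t) : t = s ∨ lev t < lev s := by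
  induction h with
  | refl => exact .inl rfl
  | tail _ hc ih => rcases ih with rfl | ih <;> have := hlev _ _ hc <;> right <;> omega

/-- A set of colors below `s` but below no child of `s` satisfies `φ` iff `s` is winning. -/
theorem sat_iff_winning {s : Z.V} {D : Set C} (hD : D ⊆ Z.label s)
    (hc : ∀ c ∈ Z.children s, ¬ D ⊆ Z.label c) : ELSat D φ ↔ Z.Winning s := by
  lift D to Finset C using Set.toFinite D
  by_contra hne
  have hcand : ELCand φ (Z.label s) D := by
    refine ⟨(Finset.coe_subset.1 hD).ssubset_of_ne ?_, by unfold Winning at hne; tauto⟩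
    rintro rfl
    exact hne Iff.rfl
  obtain ⟨D', hle, hmax⟩ := (Set.toFinite {D | ELCand φ (Z.label s) D}).exists_le_maximal hcand
  obtain ⟨c, hcs, rfl⟩ := Z.child_exists
    ⟨hmax.prop, fun E hE hDE => le_antisymm hDE (hmax.le_of_ge hE hDE)⟩
  exact hc c hcs (Finset.coe_subset.2 hle)

variable (Z) in
/-- The `k`-th child of `t`, counted cyclically. -/
noncomputable def cyclicChild (k : ℕ) (t : Z.V) : Z.V :=
  (Z.children t).toList.getD (k % (Z.children t).card) t

theorem cyclicChild_mem {t : Z.V} (ht : ¬ Z.IsLeaf t) (k : ℕ) :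
    Z.cyclicChild k t ∈ Z.children t := by
  have hpos := Finset.card_pos.2 (Finset.nonempty_iff_ne_empty.2 ht)
  have hlt := Nat.mod_lt k hpos
  rw [← Finset.length_toList] at hlt
  rw [cyclicChild, List.getD_eq_getElem _ _ (by simpa using hlt)]
  exact Finset.mem_toList.1 (List.getElem_mem _)

theorem exists_cyclicChild_eq {t c : Z.V} (hc : c ∈ Z.children t) (M : ℕ) :
    ∃ k ≥ M, Z.cyclicChild k t = c := by
  obtain ⟨j, hj, rfl⟩ := List.getElem_of_mem (Finset.mem_toList.2 hc)
  have hj' : j < (Z.children t).card := by simpa using hj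
  refine ⟨j + (Z.children t).card * M, ?_, ?_⟩
  · nlinarith
  · rw [cyclicChild, Nat.add_mul_mod_self_left, Nat.mod_eq_of_lt hj',
      List.getD_eq_getElem _ _ hj]

/-- The child of `t` that is due after history `h` when the children of `t` are chosen in
cyclic order. -/
noncomputable def nextChild (h : List (N × Z.V)) (t : Z.V) : Z.V :=
  Z.cyclicChild (h.countP fun p => p.2 = t) t

theorem countP_map_range {α : Type*} (ρ : ℕ → α) (p : α → Prop) [DecidablePred p] (n : ℕ) :
    ((List.range n).map ρ).countP p = Nat.count (fun i => p (ρ i)) n := by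
  induction n with
  | zero => simp
  | succ n ih => simp [List.range_succ, Nat.count_succ, ih, List.countP_cons]

theorem frequently_child_of_nextChild {ρ : ℕ → N × Z.V} {s : Z.V}
    (hs : ∃ᶠ n in atTop, (ρ n).2 = s)
    (hnext : ∀ n, (ρ n).2 = s → (ρ (n + 1)).2 = nextChild ((List.range n).map ρ) s)
    {c : Z.V} (hc : c ∈ Z.children s) : ∃ᶠ n in atTop, (ρ n).2 = c := by
  have hinf := Nat.frequently_atTop_iff_infinite.1 hs
  refine frequently_atTop.2 fun M => ?_
  obtain ⟨k, hk, rfl⟩ := exists_cyclicChild_eq hc M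
  refine ⟨Nat.nth (fun n => (ρ n).2 = s) k + 1,
    hk.trans ((Nat.nth_strictMono hinf).le_apply.trans (Nat.le_succ _)), ?_⟩
  rw [hnext _ (Nat.nth_mem_of_infinite hinf k), nextChild, countP_map_range ρ (fun p => p.2 = s),
    Nat.count_nth_of_infinite hinf]

end ZielonkaTree

section Plays

variable {C N : Type} [Fintype C] [DecidableEq C] {φ : ELFormula C} {Z : ZielonkaTree C φ}
  {A : Arena N} {γ : N → Finset C} {anch : N → Z.V → Z.V} {lev : Z.V → ℕ} {ρ : ℕ → N × Z.V}

theorem PArena.mem_E_of_leaf {p q : N × Z.V} (hp : Z.IsLeaf p.2) :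
    q ∈ (PArena A Z anch).E p ↔ q.1 ∈ A.E p.1 ∧ q.2 = anch p.1 p.2 := by
  simp [PArena, hp]

theorem PArena.mem_E_of_not_leaf {p q : N × Z.V} (hp : ¬ Z.IsLeaf p.2) :
    q ∈ (PArena A Z anch).E p ↔ q.1 = p.1 ∧ q.2 ∈ Z.children p.2 := by
  simp [PArena, hp]

theorem PArena.exists_leaf (hlev : ∀ s t : Z.V, t ∈ Z.children s → lev s = lev t + 1)
    (hρ : (PArena A Z anch).IsPlay ρ) (n : ℕ) :
    ∃ m ≥ n, Z.IsLeaf (ρ m).2 ∧ (ρ m).1 = (ρ n).1 := by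
  induction h : lev (ρ n).2 generalizing n with
  | zero =>
    refine ⟨n, le_rfl, ?_, rfl⟩
    by_contra hl
    have := hlev _ _ ((PArena.mem_E_of_not_leaf hl).1 (hρ n)).2
    omega
  | succ k ih =>
    by_cases hl : Z.IsLeaf (ρ n).2
    · exact ⟨n, le_rfl, hl, rfl⟩
    · obtain ⟨h1, h2⟩ := (PArena.mem_E_of_not_leaf hl).1 (hρ n)
      obtain ⟨m, hm, hml, hm1⟩ := ih (n + 1) (by have := hlev _ _ h2; omega)
      exact ⟨m, by omega, hml, hm1.trans h1⟩

/-- Every play of the parity game eventually stays below a tree vertex visited infinitely often. -/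
theorem PArena.exists_dominating
    (hanch : ∀ v t, Z.IsAnchor (γ v) t (anch v t))
    (hlev : ∀ s t : Z.V, t ∈ Z.children s → lev s = lev t + 1)
    (hρ : (PArena A Z anch).IsPlay ρ) :
    ∃ s, (∃ᶠ n in atTop, (ρ n).2 = s) ∧ ∀ᶠ n in atTop, Z.anc s (ρ n).2 := by
  have hne : {s | ∃ᶠ n in atTop, (ρ n).2 = s}.Nonempty :=
    Frequently.exists_of_finite (Frequently.of_forall fun n => ⟨_, rfl⟩)
  obtain ⟨s, hs, hmax⟩ := Set.exists_max_image _ lev (Set.toFinite _) hne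
  refine ⟨s, hs, ?_⟩
  have hbound : ∀ᶠ n in atTop, lev (ρ n).2 ≤ lev s := by
    by_contra hcon
    obtain ⟨t, ht⟩ := Frequently.exists_of_finite
      ((not_eventually.1 hcon).mono fun n hn => (⟨_, rfl, hn⟩ : ∃ t, (ρ n).2 = t ∧ ¬ lev t ≤ lev s))
    obtain ⟨n, hn⟩ := ht.exists
    exact hn.2 (hmax t (ht.mono fun _ h => h.1))
  obtain ⟨M, hM⟩ := eventually_atTop.1 hbound
  obtain ⟨n₀, hn₀, rfl⟩ := frequently_atTop.1 hs M
  refine eventually_atTop.2 ⟨n₀, fun n hn => ?_⟩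
  induction n, hn using Nat.le_induction with
  | base => exact .refl
  | succ n hn ih =>
    by_cases hl : Z.IsLeaf (ρ n).2
    · have h2 := ((PArena.mem_E_of_leaf hl).1 (hρ n)).2
      have ha := (hanch (ρ n).1 (ρ n).2).1
      rw [← h2] at ha
      rcases ih.total ha with h | h
      · exact h
      · rcases h.eq_or_lt hlev with h | h
        · rw [h]; exact .refl
        · have := hM (n + 1) (by omega)
          omega
    · exact ih.tail ((PArena.mem_E_of_not_leaf hl).1 (hρ n)).2

theorem parityWin_iff_winning (hlev : ∀ s t : Z.V, t ∈ Z.children s → lev s = lev t + 1)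
    {s : Z.V} (hs : ∃ᶠ n in atTop, (ρ n).2 = s) (hdom : ∀ᶠ n in atTop, Z.anc s (ρ n).2) :
    ParityWin (POmega Z lev) ρ ↔ Z.Winning s := by
  let P : ℕ := POmega Z lev ((ρ 0).1, s)
  have hP : ∃ᶠ n in atTop, POmega Z lev (ρ n) = P := hs.mono fun n hn => by
    simp only [P, POmega]
    rw [hn]
  have hmax : ∀ q, (∃ᶠ n in atTop, POmega Z lev (ρ n) = q) → q ≤ P := by
    intro q hq
    obtain ⟨n, rfl, hn⟩ := (hq.and_eventually hdom).exists
    rcases hn.eq_or_lt hlev with h | h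
    · simp only [P, POmega]
      rw [h]
    · simp only [P, POmega]
      split_ifs <;> omega
  have heven : Even P ↔ Z.Winning s := by
    by_cases h : Z.Winning s <;> simp [P, POmega, h]
  simp only [ParityWin, ← frequently_atTop, ← heven]
  constructor
  · rintro ⟨p, hp, hfreq, hle⟩
    rwa [le_antisymm (hle P hP) (hmax p hfreq)]
  · exact fun h => ⟨P, h, hP, hmax⟩

theorem elSat_iff_winning (hanch : ∀ v t, Z.IsAnchor (γ v) t (anch v t))
    (hlev : ∀ s t : Z.V, t ∈ Z.children s → lev s = lev t + 1)
    (hρ : (PArena A Z anch).IsPlay ρ) {s : Z.V}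
    (hs : ∃ᶠ n in atTop, (ρ n).2 = s) (hdom : ∀ᶠ n in atTop, Z.anc s (ρ n).2)
    (hchild : ∀ c ∈ Z.children s, ∃ᶠ n in atTop, (ρ n).2 = c) :
    ELSat {c | ∃ᶠ n in atTop, c ∈ γ (ρ n).1} φ ↔ Z.Winning s := by
  apply ZielonkaTree.sat_iff_winning
  · intro c hc
    obtain ⟨M, hM⟩ := eventually_atTop.1 hdom
    obtain ⟨n, hn, hcn⟩ := frequently_atTop.1 hc M
    obtain ⟨m, hm, hl, h1⟩ := PArena.exists_leaf hlev hρ n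
    have h2 := ((PArena.mem_E_of_leaf hl).1 (hρ m)).2
    have hsub := (hM (m + 1) (by omega)).label_subset
    rw [h2] at hsub
    exact hsub ((hanch _ _).2.1 (h1 ▸ hcn))
  · intro t ht hsub
    have hleave : ∃ᶠ n in atTop, ∃ c, c ∈ γ (ρ n).1 ∧ c ∉ Z.label t := by
      refine frequently_atTop.2 fun M => ?_
      obtain ⟨a, ha, rfl⟩ := frequently_atTop.1 (hchild t ht) M
      obtain ⟨b, hb, hbs⟩ := frequently_atTop.1 hs a
      by_contra! hstay
      have hanc : ∀ n ≥ a, Z.anc (ρ a).2 (ρ n).2 := by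
        intro n hn
        induction n, hn using Nat.le_induction with
        | base => exact .refl
        | succ n hn ih =>
          by_cases hl : Z.IsLeaf (ρ n).2
          · rw [((PArena.mem_E_of_leaf hl).1 (hρ n)).2]
            exact (hanch _ _).2.2 _ ih (hstay n (by omega))
          · exact ih.tail ((PArena.mem_E_of_not_leaf hl).1 (hρ n)).2
      have := hlev _ _ ht
      rcases (hanc b hb).eq_or_lt hlev with h | h
      · rw [← h, hbs] at this; omega
      · rw [hbs] at h; omega
    obtain ⟨c, hc⟩ := hleave.exists_of_finite
    obtain ⟨n, hn⟩ := hc.exists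
    exact hn.2 (hsub (hc.mono fun _ h => h.1))

/-- Reading a sequence at an unbounded index that grows by at most one preserves which events occur
infinitely often. -/
theorem frequently_comp_iff {p : ℕ → Prop} {k : ℕ → ℕ} (h0 : k 0 = 0)
    (hmono : Monotone k) (hstep : ∀ n, k (n + 1) ≤ k n + 1) (hunb : ∀ i, ∃ n, i ≤ k n) :
    (∃ᶠ n in atTop, p (k n)) ↔ ∃ᶠ n in atTop, p n := by
  refine ⟨(tendsto_atTop_atTop_of_monotone hmono hunb).frequently, fun h => ?_⟩
  have hle : ∀ n, k n ≤ n := by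
    intro n
    induction n with
    | zero => omega
    | succ n ih => have := hstep n; omega
  have hsurj : ∀ i, ∃ n, k n = i := by
    intro i
    induction i with
    | zero => exact ⟨0, h0⟩
    | succ i ih =>
      classical
      have hex := hunb (i + 1)
      have hfind := Nat.find_spec hex
      cases hn : Nat.find hex with
      | zero => rw [hn] at hfind; omega
      | succ m =>
        have := Nat.find_min hex (m := m) (by omega)
        rw [hn] at hfind
        have := hstep m
        exact ⟨m + 1, by omega⟩
  refine frequently_atTop.2 fun M => ?_
  obtain ⟨i, hi, hpi⟩ := frequently_atTop.1 h M
  obtain ⟨n, rfl⟩ := hsurj i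
  exact ⟨n, hi.trans (hle n), hpi⟩

/-- The Emerson-Lei play underlying a play of the parity game. -/
theorem PArena.exists_projection (hlev : ∀ s t : Z.V, t ∈ Z.children s → lev s = lev t + 1)
    (hρ : (PArena A Z anch).IsPlay ρ) :
    ∃ π : ℕ → N, (∀ n, (ρ n).1 = π (Nat.count (fun m => Z.IsLeaf (ρ m).2) n)) ∧
      ∀ i, ∃ n, Z.IsLeaf (ρ n).2 ∧ Nat.count (fun m => Z.IsLeaf (ρ m).2) n = i := by
  have hinf : {m | Z.IsLeaf (ρ m).2}.Infinite :=
    Nat.frequently_atTop_iff_infinite.1 <| frequently_atTop.2 fun n =>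
      (PArena.exists_leaf hlev hρ n).imp fun m hm => ⟨hm.1, hm.2.1⟩
  have hconst : ∀ n m, n ≤ m → Nat.count (fun m => Z.IsLeaf (ρ m).2) n =
      Nat.count (fun m => Z.IsLeaf (ρ m).2) m → (ρ n).1 = (ρ m).1 := by
    intro n m hnm
    induction m, hnm using Nat.le_induction with
    | base => exact fun _ => rfl
    | succ m hm ih =>
      intro h
      have hmono := Nat.count_monotone (fun m => Z.IsLeaf (ρ m).2) hm
      rw [Nat.count_succ] at h
      by_cases hl : Z.IsLeaf (ρ m).2
      · rw [if_pos hl] at h; omega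
      · rw [if_neg hl] at h
        exact (ih h).trans ((PArena.mem_E_of_not_leaf hl).1 (hρ m)).1.symm
  refine ⟨fun i => (ρ (Nat.nth (fun m => Z.IsLeaf (ρ m).2) i)).1, fun n => ?_, fun i =>
    ⟨_, Nat.nth_mem_of_infinite hinf i, Nat.count_nth_of_infinite hinf i⟩⟩
  have h := Nat.count_nth_of_infinite hinf (Nat.count (fun m => Z.IsLeaf (ρ m).2) n)
  rcases le_total n (Nat.nth (fun m => Z.IsLeaf (ρ m).2)
    (Nat.count (fun m => Z.IsLeaf (ρ m).2) n)) with hle | hle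
  · exact hconst _ _ hle h.symm
  · exact (hconst _ _ hle h).symm

theorem winsParity_of_winsEL (hanch : ∀ v t, Z.IsAnchor (γ v) t (anch v t))
    (hlev : ∀ s t : Z.V, t ∈ Z.children s → lev s = lev t + 1) {v : N}
    (h : WinsFrom A (ELObjective γ φ) v) :
    WinsFrom (PArena A Z anch) (ParityWin (POmega Z lev)) (v, Z.root) := by
  obtain ⟨σ, hσ, hwin⟩ := h
  let past (h : List (N × Z.V)) : List N := (h.filter fun p => Z.IsLeaf p.2).map Prod.fst
  refine ⟨fun h u => if Z.IsLeaf u.2 then (σ (past h) u.1, anch u.1 u.2)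
    else (u.1, ZielonkaTree.nextChild h u.2), fun h u hu => ?_, fun ρ hρ h0 hcomp => ?_⟩
  · by_cases hl : Z.IsLeaf u.2
    · simp only [if_pos hl]
      refine (PArena.mem_E_of_leaf hl).2 ⟨hσ _ _ ?_, rfl⟩
      simpa [PArena, hl] using hu
    · simp only [if_neg hl]
      exact (PArena.mem_E_of_not_leaf hl).2 ⟨rfl, ZielonkaTree.cyclicChild_mem hl _⟩
  beta_reduce at hcomp
  obtain ⟨π, hπ, hsurj⟩ := PArena.exists_projection hlev hρ
  have hpast : ∀ n, past ((List.range n).map ρ) =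
      (List.range (Nat.count (fun m => Z.IsLeaf (ρ m).2) n)).map π := by
    intro n
    induction n with
    | zero => simp [past]
    | succ n ih =>
      by_cases hl : Z.IsLeaf (ρ n).2
      · simp [past, List.range_succ, Nat.count_succ, hl, ← hπ] at ih ⊢
        exact ih
      · simp [past, List.range_succ, Nat.count_succ, hl] at ih ⊢
        exact ih
  have hsucc : ∀ n, Z.IsLeaf (ρ n).2 →
      π (Nat.count (fun m => Z.IsLeaf (ρ m).2) n + 1) = (ρ (n + 1)).1 := by
    intro n hl
    rw [hπ (n + 1), Nat.count_succ, if_pos hl]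
  have hel : ELObjective γ φ π := by
    refine hwin π (fun i => ?_) ?_ fun i hi => ?_
    · obtain ⟨n, hl, rfl⟩ := hsurj i
      rw [hsucc n hl, ← hπ]
      exact ((PArena.mem_E_of_leaf hl).1 (hρ n)).1
    · simpa [h0] using (hπ 0).symm
    · obtain ⟨n, hl, rfl⟩ := hsurj i
      rw [← hπ] at hi
      rw [hsucc n hl, ← hπ, hcomp n (.inr ⟨hl, hi⟩), if_pos hl, hpast]
  obtain ⟨s, hs, hdom⟩ := PArena.exists_dominating hanch hlev hρ
  rw [parityWin_iff_winning hlev hs hdom]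
  by_contra hlose
  refine hlose ((elSat_iff_winning hanch hlev hρ hs hdom fun c hc => ?_).1 ?_)
  · refine ZielonkaTree.frequently_child_of_nextChild hs (fun n hn => ?_) hc
    subst hn
    have hl : ¬ Z.IsLeaf (ρ n).2 := Finset.ne_empty_of_mem hc
    rw [hcomp n (.inl ⟨hl, hlose⟩), if_neg hl]
  · simp only [ELObjective, ← frequently_atTop] at hel
    convert hel using 3 with c
    simp only [hπ]
    refine frequently_comp_iff (p := fun i => c ∈ γ (π i)) (Nat.count_zero _)
      (Nat.count_monotone _) (fun n => ?_) fun i => ?_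
    · rw [Nat.count_succ]; split_ifs <;> omega
    · exact (hsurj i).imp fun n hn => hn.2.ge

/-- A position of the parity game reached along a fixed Emerson-Lei play: the index of the current
node, the history, and the current tree vertex. -/
structure SimState (Z : ZielonkaTree C φ) (N : Type) where
  idx : ℕ
  hist : List (N × Z.V)
  vertex : Z.V

variable (anch) in
/-- The play of the parity game that follows the Emerson-Lei play `π`, where `choose` selects
the children at inner vertices. -/
def simulate (choose : List (N × Z.V) → N × Z.V → Z.V) (π : ℕ → N) : ℕ → SimState Z N
  | 0 => ⟨0, [], Z.root⟩
  | n + 1 =>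
    let x := simulate choose π n
    if Z.IsLeaf x.vertex then
      ⟨x.idx + 1, x.hist ++ [(π x.idx, x.vertex)], anch (π x.idx) x.vertex⟩
    else ⟨x.idx, x.hist ++ [(π x.idx, x.vertex)], choose x.hist (π x.idx, x.vertex)⟩

section Simulate

variable {choose : List (N × Z.V) → N × Z.V → Z.V} {π π' : ℕ → N}

theorem simulate_succ_of_leaf {n : ℕ} (hl : Z.IsLeaf (simulate anch choose π n).vertex) :
    simulate anch choose π (n + 1) =
      ⟨(simulate anch choose π n).idx + 1, (simulate anch choose π n).hist ++
        [(π (simulate anch choose π n).idx, (simulate anch choose π n).vertex)],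
        anch (π (simulate anch choose π n).idx) (simulate anch choose π n).vertex⟩ := by
  simp [simulate, hl]

theorem simulate_succ_of_not_leaf {n : ℕ} (hl : ¬ Z.IsLeaf (simulate anch choose π n).vertex) :
    simulate anch choose π (n + 1) =
      ⟨(simulate anch choose π n).idx, (simulate anch choose π n).hist ++
        [(π (simulate anch choose π n).idx, (simulate anch choose π n).vertex)],
        choose (simulate anch choose π n).hist
          (π (simulate anch choose π n).idx, (simulate anch choose π n).vertex)⟩ := by
  simp [simulate, hl]

theorem simulate_idx_succ (n : ℕ) :
    (simulate anch choose π (n + 1)).idx = (simulate anch choose π n).idx +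
      if Z.IsLeaf (simulate anch choose π n).vertex then 1 else 0 := by
  by_cases hl : Z.IsLeaf (simulate anch choose π n).vertex
  · rw [simulate_succ_of_leaf hl, if_pos hl]
  · rw [simulate_succ_of_not_leaf hl, if_neg hl, add_zero]

theorem simulate_idx_mono : Monotone fun n => (simulate anch choose π n).idx :=
  monotone_nat_of_le_succ fun n => by rw [simulate_idx_succ]; omega

theorem simulate_idx_unique {n m : ℕ} (hn : Z.IsLeaf (simulate anch choose π n).vertex)
    (hm : Z.IsLeaf (simulate anch choose π m).vertex)
    (h : (simulate anch choose π n).idx = (simulate anch choose π m).idx) : n = m := by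
  wlog hlt : n < m generalizing n m
  · rcases (not_lt.1 hlt).eq_or_lt with h' | h'
    · exact h'.symm
    · exact (this hm hn h.symm h').symm
  have := simulate_idx_mono (anch := anch) (choose := choose) (π := π) (Nat.succ_le_of_lt hlt)
  simp only [Nat.succ_eq_add_one, simulate_idx_succ n, if_pos hn] at this
  omega

theorem simulate_congr {k : ℕ} (hagree : ∀ i ≤ k, π i = π' i) (n : ℕ)
    (hn : (simulate anch choose π n).idx ≤ k) :
    simulate anch choose π n = simulate anch choose π' n := by
  induction n with
  | zero => rfl
  | succ n ih =>
    have hn' := (simulate_idx_mono (anch := anch) (choose := choose) (π := π)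
      (Nat.le_succ n)).trans hn
    have heq := ih hn'
    simp only [simulate, ← heq, hagree _ hn']

theorem simulate_hist (n : ℕ) : (simulate anch choose π n).hist = (List.range n).map fun m =>
    (π (simulate anch choose π m).idx, (simulate anch choose π m).vertex) := by
  induction n with
  | zero => rfl
  | succ n ih =>
    rw [List.range_succ, List.map_append, ← ih]
    by_cases hl : Z.IsLeaf (simulate anch choose π n).vertex
    · rw [simulate_succ_of_leaf hl]; rfl
    · rw [simulate_succ_of_not_leaf hl]; rfl

end Simulate

theorem winsEL_of_winsParity (hanch : ∀ v t, Z.IsAnchor (γ v) t (anch v t))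
    (hlev : ∀ s t : Z.V, t ∈ Z.children s → lev s = lev t + 1) {v : N}
    (h : WinsFrom (PArena A Z anch) (ParityWin (POmega Z lev)) (v, Z.root)) :
    WinsFrom A (ELObjective γ φ) v := by
  classical
  obtain ⟨τ, hτ, hwin⟩ := h
  let choose (h : List (N × Z.V)) (u : N × Z.V) : Z.V :=
    if Z.Winning u.2 then ZielonkaTree.nextChild h u.2 else (τ h u).2
  let pos (h : List N) (u : N) : ℕ → SimState Z N := simulate anch choose fun i => h.getD i u
  let atLeaf (h : List N) (u : N) (n : ℕ) : Prop :=
    (pos h u n).idx = h.length ∧ Z.IsLeaf (pos h u n).vertex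
  refine ⟨fun h u => if hex : ∃ n, atLeaf h u n then
    (τ (pos h u hex.choose).hist (u, (pos h u hex.choose).vertex)).1
    else (A.E_nonempty u).some, fun h u hu => ?_, fun π hπ h0 hcomp => ?_⟩
  · beta_reduce
    split_ifs with hex
    · have hl := hex.choose_spec.2
      exact ((PArena.mem_E_of_leaf (p := (u, (pos h u hex.choose).vertex)) hl).1
        (hτ _ _ (.inr ⟨hl, hu⟩))).1
    · exact (A.E_nonempty u).some_mem
  beta_reduce at hcomp
  let x : ℕ → SimState Z N := simulate anch choose π
  let ρ : ℕ → N × Z.V := fun n => (π (x n).idx, (x n).vertex)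
  have hhist : ∀ n, (x n).hist = (List.range n).map ρ := simulate_hist
  have hleaf : ∀ n, Z.IsLeaf (x n).vertex →
      ρ (n + 1) = (π ((x n).idx + 1), anch (ρ n).1 (ρ n).2) := by
    intro n hl
    simp only [ρ, x, simulate_succ_of_leaf hl]
  have hinner : ∀ n, ¬ Z.IsLeaf (x n).vertex →
      ρ (n + 1) = ((ρ n).1, choose ((List.range n).map ρ) (ρ n)) := by
    intro n hl
    rw [← hhist]
    simp only [ρ, x, simulate_succ_of_not_leaf hl]
  have hmove : ∀ n, Z.IsLeaf (x n).vertex → π (x n).idx ∈ A.Vex →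
      π ((x n).idx + 1) = (τ ((List.range n).map ρ) (ρ n)).1 := by
    intro n hl hv
    have hagree : ∀ i ≤ (x n).idx,
        π i = ((List.range (x n).idx).map π).getD i (π (x n).idx) := by
      intro i hi
      rcases hi.eq_or_lt with rfl | hi
      · simp
      · simp [List.getD_eq_getElem?_getD, hi]
    have heq : ∀ m, (x m).idx ≤ (x n).idx →
        x m = pos ((List.range (x n).idx).map π) (π (x n).idx) m :=
      fun m hm => simulate_congr hagree m hm
    have hn : atLeaf ((List.range (x n).idx).map π) (π (x n).idx) n := by
      simp only [atLeaf, ← heq n le_rfl]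
      simpa using hl
    have hex : ∃ m, atLeaf ((List.range (x n).idx).map π) (π (x n).idx) m := ⟨n, hn⟩
    have hm : hex.choose = n := simulate_idx_unique hex.choose_spec.2 hn.2
      (hex.choose_spec.1.trans hn.1.symm)
    rw [hcomp _ hv, dif_pos hex, hm, ← heq n le_rfl, hhist]
  have hplay : (PArena A Z anch).IsPlay ρ := by
    intro n
    by_cases hl : Z.IsLeaf (x n).vertex
    · rw [hleaf n hl]
      exact (PArena.mem_E_of_leaf hl).2 ⟨hπ _, rfl⟩
    · rw [hinner n hl]
      refine (PArena.mem_E_of_not_leaf hl).2 ⟨rfl, ?_⟩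
      by_cases hw : Z.Winning (ρ n).2
      · simp only [choose, if_pos hw]
        exact ZielonkaTree.cyclicChild_mem hl _
      · simp only [choose, if_neg hw]
        exact ((PArena.mem_E_of_not_leaf hl).1 (hτ _ _ (.inl ⟨hl, hw⟩))).2
  have hpar : ParityWin (POmega Z lev) ρ := by
    refine hwin ρ hplay (by simp [ρ, x, simulate, h0]) fun n hn => ?_
    have hlegal := hτ ((List.range n).map ρ) _ hn
    by_cases hl : Z.IsLeaf (x n).vertex
    · have hv : π (x n).idx ∈ A.Vex := by
        rcases hn with hn | hn
        · exact absurd hl hn.1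
        · exact hn.2
      rw [hleaf n hl, hmove n hl hv]
      exact Prod.ext rfl ((PArena.mem_E_of_leaf hl).1 hlegal).2.symm
    · have hw : ¬ Z.Winning (ρ n).2 := by
        rcases hn with hn | hn
        · exact hn.2
        · exact absurd hn.1 hl
      rw [hinner n hl]
      simp only [choose, if_neg hw]
      exact Prod.ext ((PArena.mem_E_of_not_leaf hl).1 hlegal).1.symm rfl
  obtain ⟨s, hs, hdom⟩ := PArena.exists_dominating hanch hlev hplay
  have hw := (parityWin_iff_winning hlev hs hdom).1 hpar
  have hsat := (elSat_iff_winning hanch hlev hplay hs hdom fun c hc =>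
    ZielonkaTree.frequently_child_of_nextChild hs (fun n hn => by
      subst hn
      have hl : ¬ Z.IsLeaf (ρ n).2 := Finset.ne_empty_of_mem hc
      rw [hinner n hl]
      simp only [choose, if_pos hw]) hc).2 hw
  simp only [ELObjective, ← frequently_atTop]
  convert hsat using 3 with c
  refine (frequently_comp_iff (p := fun i => c ∈ γ (π i)) (k := fun n => (x n).idx) rfl
    simulate_idx_mono (fun n => ?_) fun i => ?_).symm
  · simp only [x, simulate_idx_succ n]; split_ifs <;> omega
  · induction i with
    | zero => exact ⟨0, Nat.zero_le _⟩
    | succ i ih =>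
      obtain ⟨n, hn⟩ := ih
      obtain ⟨m, hm, hl, -⟩ := PArena.exists_leaf hlev hplay n
      have hnm : (x n).idx ≤ (x m).idx := simulate_idx_mono hm
      refine ⟨m + 1, ?_⟩
      simp only [x, simulate_succ_of_leaf hl]
      exact Nat.succ_le_succ (hn.trans hnm)

end Plays

/-- For every node `v` of an Emerson-Lei game `G`, the existential player wins `v` in `G`
if and only if the existential player wins `(v, r)` in the parity game `P_G`, where `r`
is the root of the Zielonka tree `Z_φ`, `anch` is the anchor-node function, and `lev` is
the level function of `Z_φ` (with `lev(r) = |C|` and decreasing by one along edges). -/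
theorem winsEL_iff_wins_parity
    {C N : Type} [Fintype C] [DecidableEq C] (φ : ELFormula C) (Z : ZielonkaTree C φ)
    (A : Arena N) (γ : N → Finset C)
    (anch : N → Z.V → Z.V) (hanch : ∀ v t, Z.IsAnchor (γ v) t (anch v t))
    (lev : Z.V → ℕ) (hlev_root : lev Z.root = Fintype.card C)
    (hlev : ∀ s t : Z.V, t ∈ Z.children s → lev s = lev t + 1)
    (v : N) :
    WinsFrom A (ELObjective γ φ) v ↔
      WinsFrom (PArena A Z anch) (ParityWin (POmega Z lev)) (v, Z.root) := by
  exact ⟨winsParity_of_winsEL hanch hlev, winsEL_of_winsParity hanch hlev⟩
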